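/- With the notation of the context, the system A₁X₁ = C₁, X₁B₁ = C₂, A₂X₂ = C₃, X₂B₂ = C₄, A₃X₁B₃ + A₄X₂B₄ = C_c (in unknowns X₁, X₂) has a solution if and only if A₁C₂ = C₁B₁, A₂C₄ = C₃B₂, R_{A₁}C₁ = 0, R_{A₂}C₃ = 0, C₂L_{B₁} = 0, C₄L_{B₂} = 0, R_M R_A E = 0, R_A E L_D = 0, E L_B L_N = 0 and R_C E L_B = 0. -/

import Mathlib

open scoped Quaternion Classical
open Matrix

noncomputable section

/-- The four Moore–Penrose conditions for `X` to be the Moore–Penrose inverse of `A`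
over the real quaternions. -/
def IsMP {m n : Type*} [Fintype m] [Fintype n]
    (A : Matrix m n ℍ[ℝ]) (X : Matrix n m ℍ[ℝ]) : Prop :=
  A * X * A = A ∧ X * A * X = X ∧ (A * X)ᴴ = A * X ∧ (X * A)ᴴ = X * A

/-- The Moore–Penrose inverse `A†` of a quaternion matrix (it exists and is unique). -/
def dg {m n : Type*} [Fintype m] [Fintype n]
    (A : Matrix m n ℍ[ℝ]) : Matrix n m ℍ[ℝ] :=
  if h : ∃ X, IsMP A X then h.choose else 0

/-- `L_A = I - A† A`. -/
def lproj {m n : Type*} [Fintype m] [Fintype n] [DecidableEq n]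
    (A : Matrix m n ℍ[ℝ]) : Matrix n n ℍ[ℝ] :=
  1 - dg A * A

/-- `R_A = I - A A†`. -/
def rproj {m n : Type*} [Fintype m] [Fintype n] [DecidableEq m]
    (A : Matrix m n ℍ[ℝ]) : Matrix m m ℍ[ℝ] :=
  1 - A * dg A

theorem quaternion_eq_zero_of_conjTranspose_mul_self {m n : Type*} [Fintype m]
    (A : Matrix m n ℍ[ℝ]) (h : Aᴴ * A = 0) :
    A = 0 := by
  ext1 i j
  have h1 : ∑ x, star (A x j) * A x j = 0 := by
    simpa [Matrix.mul_apply] using congrFun (congrFun h j) j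
  have h2 : ∑ x, Quaternion.normSq (A x j) = 0 := by
    have h3 : ((∑ x, Quaternion.normSq (A x j) : ℝ) : ℍ[ℝ]) = 0 := by
      rw [← h1, ← Quaternion.algebraMap_def, map_sum]
      exact Finset.sum_congr rfl fun x _ => (Quaternion.star_mul_self (A x j)).symm
    exact Quaternion.coe_injective (by simpa using h3)
  have h4 := (Finset.sum_eq_zero_iff_of_nonneg
    (fun x _ => Quaternion.normSq_nonneg)).1 h2 i (Finset.mem_univ i)
  exact Quaternion.normSq_eq_zero.1 h4

section MoorePenrose

variable {k l m n : Type*} [Fintype m] [Fintype n]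

theorem exists_sq_mul_eq_of_conjTranspose_eq {H : Matrix n n ℍ[ℝ]} (hH : Hᴴ = H) :
    ∃ W : Matrix n n ℍ[ℝ], H * (H * W) = H := by
  let T : Matrix n n ℍ[ℝ] →ₗ[ℝ] Matrix n n ℍ[ℝ] := LinearMap.mulLeft ℝ H
  have hker : LinearMap.ker (T ∘ₗ T) = LinearMap.ker T := by
    ext Y
    simp only [LinearMap.mem_ker, LinearMap.comp_apply, T, LinearMap.mulLeft_apply]
    refine ⟨fun h => quaternion_eq_zero_of_conjTranspose_mul_self _ ?_, fun h => by simp [h]⟩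
    rw [Matrix.conjTranspose_mul, hH, Matrix.mul_assoc, h, Matrix.mul_zero]
  have hrange : LinearMap.range (T ∘ₗ T) = LinearMap.range T := by
    refine Submodule.eq_of_le_of_finrank_eq (LinearMap.range_comp_le_range T T) ?_
    have h1 := LinearMap.finrank_range_add_finrank_ker T
    have h2 := LinearMap.finrank_range_add_finrank_ker (T ∘ₗ T)
    rw [hker] at h2
    omega
  have hmem : H ∈ LinearMap.range (T ∘ₗ T) := by
    rw [hrange]
    exact ⟨1, by simp [T]⟩
  exact hmem

theorem exists_commute_inner_inverse_of_conjTranspose_eq {H : Matrix n n ℍ[ℝ]} (hH : Hᴴ = H) :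
    ∃ P : Matrix n n ℍ[ℝ], Pᴴ = P ∧ H * P = P * H ∧ H * P * H = H := by
  obtain ⟨W, hW⟩ := exists_sq_mul_eq_of_conjTranspose_eq hH
  have hW' : Wᴴ * H * H = H := by
    simpa [Matrix.conjTranspose_mul, hH, Matrix.mul_assoc] using congrArg conjTranspose hW
  have hc : H * W = Wᴴ * H := by
    calc H * W = Wᴴ * H * H * W := by rw [hW']
      _ = Wᴴ * (H * (H * W)) := by simp only [Matrix.mul_assoc]
      _ = Wᴴ * H := by rw [hW]
  have hl : H * (Wᴴ * H * W) = H * W := by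
    rw [← hc, ← Matrix.mul_assoc, hW]
  have hr : Wᴴ * H * W * H = H * W := by
    rw [Matrix.mul_assoc Wᴴ, hc, Matrix.mul_assoc, hW']
  refine ⟨Wᴴ * H * W, ?_, hl.trans hr.symm, ?_⟩
  · simp [Matrix.conjTranspose_mul, hH, Matrix.mul_assoc]
  · rw [hl, hc, hW']

theorem exists_isMP (A : Matrix m n ℍ[ℝ]) : ∃ X, IsMP A X := by
  obtain ⟨P, hP, hcomm, hinner⟩ :=
    exists_commute_inner_inverse_of_conjTranspose_eq (Matrix.isHermitian_conjTranspose_mul_self A).eq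
  have hA : A * P * Aᴴ * A = A := by
    rw [← sub_eq_zero]
    apply quaternion_eq_zero_of_conjTranspose_mul_self
    have h : Aᴴ * (A * P * Aᴴ * A - A) = 0 := by
      rw [Matrix.mul_sub, sub_eq_zero]
      simpa only [Matrix.mul_assoc] using hinner
    have h' : A * P * Aᴴ * A - A = A * (P * Aᴴ * A - 1) := by
      simp [Matrix.mul_sub, Matrix.mul_assoc]
    nth_rewrite 1 [h']
    rw [Matrix.conjTranspose_mul, Matrix.mul_assoc, h, Matrix.mul_zero]
  have hA' : Aᴴ * A * P * Aᴴ = Aᴴ := by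
    simpa [Matrix.conjTranspose_mul, hP, Matrix.mul_assoc] using congrArg conjTranspose hA
  refine ⟨P * Aᴴ, ?_, ?_, ?_, ?_⟩
  · simpa only [Matrix.mul_assoc] using hA
  · simpa only [Matrix.mul_assoc] using congrArg (P * ·) hA'
  · simp [Matrix.conjTranspose_mul, hP, Matrix.mul_assoc]
  · rw [Matrix.mul_assoc, Matrix.conjTranspose_mul, hP,
      (Matrix.isHermitian_conjTranspose_mul_self A).eq, hcomm]

theorem mul_dg_mul_self (A : Matrix m n ℍ[ℝ]) : A * dg A * A = A := by
  rw [dg, dif_pos (exists_isMP A)]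
  exact (exists_isMP A).choose_spec.1

theorem rproj_mul_self [DecidableEq m] (A : Matrix m n ℍ[ℝ]) : rproj A * A = 0 := by
  rw [rproj, Matrix.sub_mul, Matrix.one_mul, mul_dg_mul_self, sub_self]

theorem mul_lproj_self [DecidableEq n] (A : Matrix m n ℍ[ℝ]) : A * lproj A = 0 := by
  rw [lproj, Matrix.mul_sub, Matrix.mul_one, ← Matrix.mul_assoc, mul_dg_mul_self, sub_self]

theorem rproj_mul_eq_zero_iff [DecidableEq m] (A : Matrix m n ℍ[ℝ]) (X : Matrix m k ℍ[ℝ]) :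
    rproj A * X = 0 ↔ A * (dg A * X) = X := by
  rw [rproj, Matrix.sub_mul, Matrix.one_mul, sub_eq_zero, eq_comm, Matrix.mul_assoc]

theorem mul_lproj_eq_zero_iff [DecidableEq n] (A : Matrix m n ℍ[ℝ])
    (X : Matrix k n ℍ[ℝ]) :
    X * lproj A = 0 ↔ X * dg A * A = X := by
  rw [lproj, Matrix.mul_sub, Matrix.mul_one, sub_eq_zero, eq_comm, Matrix.mul_assoc]

/-- `A Y B = E` is solvable as soon as `E` has its columns in the range of `A` and its rows in
the row space of `B`. -/
theorem mul_dg_mul_dg_mul [Fintype k] [Fintype l] [DecidableEq k] [DecidableEq n]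
    {A : Matrix k l ℍ[ℝ]} {B : Matrix m n ℍ[ℝ]} {E : Matrix k n ℍ[ℝ]}
    (hA : rproj A * E = 0) (hB : E * lproj B = 0) : A * (dg A * E * dg B) * B = E := by
  rw [← Matrix.mul_assoc, (rproj_mul_eq_zero_iff A E).1 hA, (mul_lproj_eq_zero_iff B E).1 hB]

/-- The solutions of `A X = C₁`, `X B = C₂` in terms of a free parameter. -/
theorem mul_eq_and_mul_eq_of_consistent [Fintype k] [Fintype l] [DecidableEq k]
    [DecidableEq l] [DecidableEq m] [DecidableEq n] {A : Matrix k l ℍ[ℝ]} {B : Matrix m n ℍ[ℝ]}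
    {C₁ : Matrix k m ℍ[ℝ]} {C₂ : Matrix l n ℍ[ℝ]} (h : A * C₂ = C₁ * B)
    (h₁ : rproj A * C₁ = 0) (h₂ : C₂ * lproj B = 0) (Y : Matrix l m ℍ[ℝ]) :
    A * (dg A * C₁ + lproj A * C₂ * dg B + lproj A * Y * rproj B) = C₁ ∧
      (dg A * C₁ + lproj A * C₂ * dg B + lproj A * Y * rproj B) * B = C₂ := by
  constructor
  · simp only [Matrix.mul_add, ← Matrix.mul_assoc, mul_lproj_self, Matrix.zero_mul, add_zero]
    rw [Matrix.mul_assoc, (rproj_mul_eq_zero_iff A C₁).1 h₁]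
  · have h₂' := (mul_lproj_eq_zero_iff B C₂).1 h₂
    rw [Matrix.mul_assoc] at h₂'
    simp only [Matrix.add_mul, Matrix.mul_assoc, rproj_mul_self, Matrix.mul_zero, add_zero, h₂']
    rw [← h, lproj, Matrix.sub_mul, Matrix.one_mul, Matrix.mul_assoc, add_sub_cancel]

theorem eq_dg_mul_add_lproj_mul [Fintype k] [Fintype l] [DecidableEq l] [DecidableEq m]
    (A : Matrix k l ℍ[ℝ]) (B : Matrix m n ℍ[ℝ]) (X : Matrix l m ℍ[ℝ]) :
    dg A * (A * X) + lproj A * (X * B) * dg B + lproj A * X * rproj B = X := by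
  simp only [lproj, rproj, Matrix.sub_mul, Matrix.mul_sub, Matrix.one_mul, Matrix.mul_one,
    Matrix.mul_assoc]
  abel

end MoorePenrose

/-- Solvability of the two-sided equation `A Y B + C Z D = E`. -/
theorem exists_mul_mul_add_mul_mul_eq_iff {p q a b c d : Type*} [Fintype p] [Fintype q]
    [Fintype a] [Fintype b] [Fintype c] [Fintype d]
    [DecidableEq p] [DecidableEq q] [DecidableEq a] [DecidableEq b] [DecidableEq c] [DecidableEq d]
    (A : Matrix p a ℍ[ℝ]) (B : Matrix b q ℍ[ℝ]) (C : Matrix p c ℍ[ℝ]) (D : Matrix d q ℍ[ℝ])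
    (E : Matrix p q ℍ[ℝ]) :
    (∃ (Y : Matrix a b ℍ[ℝ]) (Z : Matrix c d ℍ[ℝ]), A * Y * B + C * Z * D = E) ↔
      rproj (rproj A * C) * rproj A * E = 0 ∧ rproj A * E * lproj D = 0 ∧
        E * lproj B * lproj (D * lproj B) = 0 ∧ rproj C * E * lproj B = 0 := by
  constructor
  · rintro ⟨Y, Z, rfl⟩
    have hA : rproj A * (A * Y * B + C * Z * D) = rproj A * C * Z * D := by
      simp only [Matrix.mul_add, ← Matrix.mul_assoc, rproj_mul_self, Matrix.zero_mul, zero_add]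
    have hB : (A * Y * B + C * Z * D) * lproj B = C * Z * (D * lproj B) := by
      simp only [Matrix.add_mul, Matrix.mul_assoc, mul_lproj_self, Matrix.mul_zero, zero_add]
    refine ⟨?_, ?_, ?_, ?_⟩
    · rw [Matrix.mul_assoc, hA, ← Matrix.mul_assoc, ← Matrix.mul_assoc, rproj_mul_self,
        Matrix.zero_mul, Matrix.zero_mul]
    · rw [hA, Matrix.mul_assoc, mul_lproj_self, Matrix.mul_zero]
    · rw [hB, Matrix.mul_assoc, mul_lproj_self, Matrix.mul_zero]
    · rw [Matrix.mul_assoc, hB]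
      simp only [← Matrix.mul_assoc, rproj_mul_self, Matrix.zero_mul]
  · rintro ⟨h₁, h₂, h₃, h₄⟩
    obtain ⟨Z₀, hZ₀⟩ : ∃ Z₀, rproj A * C * Z₀ * D = rproj A * E :=
      ⟨_, mul_dg_mul_dg_mul (by rwa [← Matrix.mul_assoc]) h₂⟩
    set F := (E - C * Z₀ * D) * lproj B with hF
    have hAF : rproj A * F = 0 := by
      rw [hF, ← Matrix.mul_assoc, Matrix.mul_sub, ← hZ₀]
      simp only [Matrix.mul_assoc, sub_self, Matrix.zero_mul]
    have hCF : rproj C * F = 0 := by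
      rw [hF, ← Matrix.mul_assoc, Matrix.mul_sub, Matrix.sub_mul, h₄]
      simp only [← Matrix.mul_assoc, rproj_mul_self, Matrix.zero_mul, sub_self]
    have hFN : F * lproj (D * lproj B) = 0 := by
      rw [hF, Matrix.sub_mul, Matrix.sub_mul, h₃, Matrix.mul_assoc (C * Z₀), Matrix.mul_assoc,
        mul_lproj_self, Matrix.mul_zero, sub_zero]
    let W := dg C * F * dg (D * lproj B)
    have hW : C * W * (D * lproj B) = F := mul_dg_mul_dg_mul hCF hFN
    have hAW : rproj A * (C * W) = 0 := by
      simp only [W]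
      rw [← Matrix.mul_assoc C, (rproj_mul_eq_zero_iff C F).1 hCF, ← Matrix.mul_assoc, hAF,
        Matrix.zero_mul]
    refine ⟨dg A * (E - C * (Z₀ + W) * D) * dg B, Z₀ + W, ?_⟩
    rw [mul_dg_mul_dg_mul, sub_add_cancel]
    · rw [Matrix.mul_sub, ← hZ₀, Matrix.mul_add, Matrix.add_mul, Matrix.mul_add,
        ← Matrix.mul_assoc (rproj A) (C * W), hAW]
      simp only [Matrix.mul_assoc, Matrix.zero_mul, add_zero, sub_self]
    · rw [Matrix.mul_add, Matrix.add_mul, ← sub_sub, Matrix.sub_mul, ← hF,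
        Matrix.mul_assoc (C * W), hW, sub_self]

/-- Solvability criterion for the system (1.4) of the paper. -/
theorem quat_system_two_unknowns_twoSided_solvable_iff
    {p q m₁ a b s₁ m₂ c d s₂ : ℕ}
    (A₁ : Matrix (Fin m₁) (Fin a) ℍ[ℝ]) (C₁ : Matrix (Fin m₁) (Fin b) ℍ[ℝ])
    (B₁ : Matrix (Fin b) (Fin s₁) ℍ[ℝ]) (C₂ : Matrix (Fin a) (Fin s₁) ℍ[ℝ])
    (A₂ : Matrix (Fin m₂) (Fin c) ℍ[ℝ]) (C₃ : Matrix (Fin m₂) (Fin d) ℍ[ℝ])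
    (B₂ : Matrix (Fin d) (Fin s₂) ℍ[ℝ]) (C₄ : Matrix (Fin c) (Fin s₂) ℍ[ℝ])
    (A₃ : Matrix (Fin p) (Fin a) ℍ[ℝ]) (B₃ : Matrix (Fin b) (Fin q) ℍ[ℝ])
    (A₄ : Matrix (Fin p) (Fin c) ℍ[ℝ]) (B₄ : Matrix (Fin d) (Fin q) ℍ[ℝ])
    (Cc : Matrix (Fin p) (Fin q) ℍ[ℝ]) :
    let A := A₃ * lproj A₁
    let B := rproj B₁ * B₃
    let C := A₄ * lproj A₂
    let D := rproj B₂ * B₄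
    let M := rproj A * C
    let N := D * lproj B
    let S := C * lproj M
    let E := Cc - A₃ * dg A₁ * C₁ * B₃ - A * C₂ * dg B₁ * B₃
        - A₄ * dg A₂ * C₃ * B₄ - C * C₄ * dg B₂ * B₄
    ((∃ (X₁ : Matrix (Fin a) (Fin b) ℍ[ℝ]) (X₂ : Matrix (Fin c) (Fin d) ℍ[ℝ]),
        A₁ * X₁ = C₁ ∧ X₁ * B₁ = C₂ ∧
        A₂ * X₂ = C₃ ∧ X₂ * B₂ = C₄ ∧
        A₃ * X₁ * B₃ + A₄ * X₂ * B₄ = Cc) ↔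
      (A₁ * C₂ = C₁ * B₁ ∧ A₂ * C₄ = C₃ * B₂ ∧
       rproj A₁ * C₁ = 0 ∧ rproj A₂ * C₃ = 0 ∧
       C₂ * lproj B₁ = 0 ∧ C₄ * lproj B₂ = 0 ∧
       rproj M * rproj A * E = 0 ∧ rproj A * E * lproj D = 0 ∧
       E * lproj B * lproj N = 0 ∧ rproj C * E * lproj B = 0)) := by
  intro A B C D M N S E
  have hE : ∀ (Y : Matrix (Fin a) (Fin b) ℍ[ℝ]) (Z : Matrix (Fin c) (Fin d) ℍ[ℝ]),
      A₃ * (dg A₁ * C₁ + lproj A₁ * C₂ * dg B₁ + lproj A₁ * Y * rproj B₁) * B₃ +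
        A₄ * (dg A₂ * C₃ + lproj A₂ * C₄ * dg B₂ + lproj A₂ * Z * rproj B₂) * B₄ = Cc ↔
      A * Y * B + C * Z * D = E := by
    intro Y Z
    rw [← sub_eq_zero, ← sub_eq_zero (b := E)]
    refine Eq.congr_left ?_
    simp only [A, B, C, D, E, Matrix.mul_add, Matrix.add_mul, Matrix.mul_assoc]
    abel
  constructor
  · rintro ⟨X₁, X₂, h₁, h₂, h₃, h₄, h⟩
    refine ⟨?_, ?_, ?_, ?_, ?_, ?_,
      (exists_mul_mul_add_mul_mul_eq_iff A B C D E).1 ⟨X₁, X₂, (hE X₁ X₂).1 ?_⟩⟩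
    · rw [← h₁, ← h₂, Matrix.mul_assoc]
    · rw [← h₃, ← h₄, Matrix.mul_assoc]
    · rw [← h₁, ← Matrix.mul_assoc, rproj_mul_self, Matrix.zero_mul]
    · rw [← h₃, ← Matrix.mul_assoc, rproj_mul_self, Matrix.zero_mul]
    · rw [← h₂, Matrix.mul_assoc, mul_lproj_self, Matrix.mul_zero]
    · rw [← h₄, Matrix.mul_assoc, mul_lproj_self, Matrix.mul_zero]
    · rw [← h₁, ← h₂, ← h₃, ← h₄, eq_dg_mul_add_lproj_mul, eq_dg_mul_add_lproj_mul, h]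
  · rintro ⟨h₁, h₂, h₃, h₄, h₅, h₆, h⟩
    obtain ⟨Y, Z, hYZ⟩ := (exists_mul_mul_add_mul_mul_eq_iff A B C D E).2 h
    obtain ⟨hX₁, hX₁'⟩ := mul_eq_and_mul_eq_of_consistent h₁ h₃ h₅ Y
    obtain ⟨hX₂, hX₂'⟩ := mul_eq_and_mul_eq_of_consistent h₂ h₄ h₆ Z
    exact ⟨_, _, hX₁, hX₁', hX₂, hX₂', (hE Y Z).2 hYZ⟩
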